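/- Let σ = (t, a_1, ..., a_{ℓ-1}) and τ = (t, b_1, ..., b_{ℓ-1}) be two cycles of length ℓ ≥ 2 intersecting only in t. Then (τ ∘ σ)^ℓ ∘ σ⁻¹ equals the product of the ℓ-1 disjoint transpositions (a_1 b_1)(a_2 b_2)···(a_{ℓ-1} b_{ℓ-1}). -/

import Mathlib

theorem List.formPerm_append_cons {α : Type*} [DecidableEq α] (l m : List α) (t : α) :
    (l ++ t :: m).formPerm = (l ++ [t]).formPerm * (t :: m).formPerm := by
  induction l with
  | nil => simp
  | cons x l ih =>
    cases l with
    | nil => simp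
    | cons y l =>
      simp only [List.cons_append, List.formPerm_cons_cons] at ih ⊢
      rw [ih, mul_assoc]

theorem List.formPerm_cons_mul_formPerm_cons {α : Type*} [DecidableEq α] {t : α} {a b : List α}
    (h : (t :: (a ++ b)).Nodup) :
    (t :: b).formPerm * (t :: a).formPerm = (t :: (a ++ b)).formPerm := by
  have hb : (t :: b).Nodup := h.sublist ((List.sublist_append_right a b).cons_cons t)
  have h₁ : (t :: b).formPerm = (b ++ [t]).formPerm :=
    List.formPerm_eq_of_isRotated hb ⟨1, by simp⟩
  have h₂ : (t :: (a ++ b)).formPerm = (b ++ t :: a).formPerm :=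
    List.formPerm_eq_of_isRotated h ⟨(t :: a).length, List.rotate_append_length_eq (t :: a) b⟩
  rw [h₁, h₂, List.formPerm_append_cons b a]

theorem List.prod_zipWith_swap_apply_of_notMem {α : Type*} [DecidableEq α] {a b : List α} {x : α}
    (ha : x ∉ a) (hb : x ∉ b) : (List.zipWith Equiv.swap a b).prod x = x := by
  induction a generalizing b with
  | nil => simp
  | cons y a ih =>
    cases b with
    | nil => simp
    | cons z b =>
      simp only [List.mem_cons, not_or] at ha hb
      simp [ih ha.2 hb.2, Equiv.swap_apply_of_ne_of_ne ha.1 hb.1]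

theorem List.prod_zipWith_swap_apply_getElem {α : Type*} [DecidableEq α] {a b : List α}
    (h : (a ++ b).Nodup) (i : ℕ) (hia : i < a.length) (hib : i < b.length) :
    (List.zipWith Equiv.swap a b).prod a[i] = b[i] ∧
      (List.zipWith Equiv.swap a b).prod b[i] = a[i] := by
  induction a generalizing b i with
  | nil => simp at hia
  | cons y a ih =>
    cases b with
    | nil => simp at hib
    | cons z b =>
      simp only [List.nodup_append', List.nodup_cons, List.disjoint_cons_left,
        List.disjoint_cons_right, List.mem_cons, not_or] at h
      obtain ⟨⟨hya, ha⟩, ⟨hzb, hb⟩, ⟨hzy, hza⟩, hyb, hab⟩ := h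
      cases i with
      | zero =>
        simp [List.prod_zipWith_swap_apply_of_notMem hya hyb,
          List.prod_zipWith_swap_apply_of_notMem hza hzb]
      | succ i =>
        simp only [List.length_cons, Nat.add_lt_add_iff_right] at hia hib
        obtain ⟨h₁, h₂⟩ := ih (List.nodup_append'.2 ⟨ha, hb, hab⟩) i hia hib
        have hai := List.getElem_mem hia
        have hbi := List.getElem_mem hib
        simp only [List.zipWith_cons_cons, List.prod_cons, List.getElem_cons_succ,
          Equiv.Perm.mul_apply, h₁, h₂]
        exact ⟨Equiv.swap_apply_of_ne_of_ne (by grind) (by grind),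
          Equiv.swap_apply_of_ne_of_ne (by grind) (by grind)⟩

/-- For cycles `σ = (t, a₁, …, a_{ℓ-1})` and `τ = (t, b₁, …, b_{ℓ-1})` of length `ℓ ≥ 2`
intersecting only in `t`, `(τ ∘ σ)^ℓ ∘ σ⁻¹ = (a₁ b₁)(a₂ b₂)⋯(a_{ℓ-1} b_{ℓ-1})`. -/
theorem stmt_3 {α : Type*} [DecidableEq α] [Fintype α]
    (ℓ : ℕ) (hℓ : 2 ≤ ℓ) (t : α) (a b : List α)
    (hal : a.length = ℓ - 1) (hbl : b.length = ℓ - 1)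
    (hnd : (t :: (a ++ b)).Nodup) :
    ((t :: b).formPerm * (t :: a).formPerm) ^ ℓ * ((t :: a).formPerm)⁻¹
      = (List.zipWith Equiv.swap a b).prod := by
  have hab : (a ++ b).Nodup := hnd.of_cons
  have hta : (t :: a).Nodup := hnd.sublist ((List.sublist_append_left a b).cons_cons t)
  have ht : t ∉ a ∧ t ∉ b := by simpa using hnd.notMem
  rw [List.formPerm_cons_mul_formPerm_cons hnd, mul_inv_eq_iff_eq_mul]
  ext x
  rw [Equiv.Perm.mul_apply]
  by_cases hx : x ∈ t :: (a ++ b)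
  · obtain ⟨i, hi, rfl⟩ := List.getElem_of_mem hx
    have hi' : i < 2 * ℓ - 1 := by simp at hi; omega
    rw [List.formPerm_pow_apply_getElem _ hnd]
    have hlen : (t :: (a ++ b)).length = 2 * ℓ - 1 := by simp; omega
    rcases lt_trichotomy i (ℓ - 1) with h | h | h
    · have e : (t :: (a ++ b))[i] = (t :: a)[i]'(by simp; omega) := by grind
      have hmod : (i + ℓ) % (t :: (a ++ b)).length = i + ℓ := Nat.mod_eq_of_lt (by omega)
      have hmod' : (i + 1) % (t :: a).length = i + 1 :=
        Nat.mod_eq_of_lt (by simp; omega)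
      rw [e, List.formPerm_apply_getElem _ hta]
      simp only [hmod, hmod', List.getElem_cons_succ]
      rw [(List.prod_zipWith_swap_apply_getElem hab i (by omega) (by omega)).1]
      grind
    · have e : (t :: (a ++ b))[i] = (t :: a)[i]'(by simp; omega) := by grind
      have hmod : (i + ℓ) % (t :: (a ++ b)).length = 0 := by
        rw [show i + ℓ = (t :: (a ++ b)).length by omega, Nat.mod_self]
      have hmod' : (i + 1) % (t :: a).length = 0 := by
        rw [show i + 1 = (t :: a).length by simp; omega, Nat.mod_self]
      rw [e, List.formPerm_apply_getElem _ hta]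
      simp only [hmod, hmod', List.getElem_cons_zero]
      exact (List.prod_zipWith_swap_apply_of_notMem ht.1 ht.2).symm
    · obtain ⟨j, rfl⟩ := Nat.exists_eq_add_of_le (show ℓ ≤ i by omega)
      have e : (t :: (a ++ b))[ℓ + j] = b[j]'(by omega) := by grind
      have hmod : (ℓ + j + ℓ) % (t :: (a ++ b)).length = j + 1 := by
        rw [show ℓ + j + ℓ = j + 1 + (t :: (a ++ b)).length by omega, Nat.add_mod_right,
          Nat.mod_eq_of_lt (by omega)]
      have hb : b[j]'(by omega) ∉ t :: a := by
        have := List.getElem_mem (l := b) (n := j) (by omega)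
        grind
      rw [e, List.formPerm_apply_of_notMem hb,
        (List.prod_zipWith_swap_apply_getElem hab j (by omega) (by omega)).2]
      simp only [hmod, List.getElem_cons_succ]
      grind
  · have hx' : x ∉ t :: a ∧ x ∉ a ∧ x ∉ b := by grind
    rw [List.formPerm_apply_of_notMem hx'.1,
      List.prod_zipWith_swap_apply_of_notMem hx'.2.1 hx'.2.2]
    exact Equiv.Perm.pow_apply_eq_self_of_apply_eq_self (List.formPerm_apply_of_notMem hx) ℓ
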